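/- The Okubo algebra is a division algebra: for x, y ∈ 𝒪, if x*y = 0 then x = 0 or y = 0. -/

import Mathlib

/- The real Okubo algebra: traceless Hermitian 3×3 complex matrices with the
Okubo product x*y = μ·(xy) + conj(μ)·(yx) − (1/3)·Tr(xy)·I, μ = (3 + i√3)/6. -/

noncomputable section

open Matrix

/-- 3×3 complex matrices. -/
abbrev OkM : Type := Matrix (Fin 3) (Fin 3) ℂ

/-- The parameter μ = (3 + i√3)/6. -/
def okMu : ℂ := (3 + (Real.sqrt 3 : ℝ) * Complex.I) / 6

/-- Membership in the Okubo algebra: Hermitian and traceless. -/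
def IsOkubo (x : OkM) : Prop := x.IsHermitian ∧ x.trace = 0

/-- The Okubo product x*y = μ·(xy) + conj(μ)·(yx) − (1/3)·Tr(xy)·I. -/
def okmul (x y : OkM) : OkM :=
  okMu • (x * y) + (starRingEnd ℂ) okMu • (y * x) - ((1 / 3 : ℂ) * (x * y).trace) • (1 : OkM)

/-- The Okubo norm n(x) = (1/6)·Tr(x²). -/
def oknorm (x : OkM) : ℝ := ((1 / 6 : ℂ) * (x * x).trace).re

lemma okMu_add_conj : okMu + (starRingEnd ℂ) okMu = 1 := by
  simp only [okMu, map_div₀, map_add, map_mul, Complex.conj_ofReal, Complex.conj_I, map_ofNat]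
  ring

lemma okMu_mul_conj : okMu * (starRingEnd ℂ) okMu = 1 / 3 := by
  have h3 : ((Real.sqrt 3 : ℝ) : ℂ) ^ 2 = 3 := by
    rw [← Complex.ofReal_pow, Real.sq_sqrt (by norm_num)]
    norm_num
  simp only [okMu, map_div₀, map_add, map_mul, Complex.conj_ofReal, Complex.conj_I, map_ofNat]
  linear_combination (-(1 / 36 : ℂ) * Complex.I ^ 2) * h3 - (1 / 12 : ℂ) * Complex.I_sq

/-- The polarized Cayley-Hamilton identity for traceless 3×3 matrices. -/
lemma cayley_hamilton_polarized {x y : OkM} (hx : x.trace = 0) (hy : y.trace = 0) :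
    x * y * x + y * x * x + x * x * y =
      (x * y).trace • x + ((1 / 2 : ℂ) * (x * x).trace) • y + (x * x * y).trace • (1 : OkM) := by
  have hx2 : x 2 2 = -x 0 0 - x 1 1 := by
    rw [Matrix.trace_fin_three] at hx
    linear_combination hx
  have hy2 : y 2 2 = -y 0 0 - y 1 1 := by
    rw [Matrix.trace_fin_three] at hy
    linear_combination hy
  ext i j
  fin_cases i <;> fin_cases j <;>
    simp [Matrix.mul_apply, Fin.sum_univ_three, Matrix.trace_fin_three, hx2, hy2] <;> ring

/-- The flexible composition law `(x * y) * x = n(x) y` of the Okubo algebra. -/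
lemma okmul_okmul_self {x y : OkM} (hx : x.trace = 0) (hy : y.trace = 0) :
    okmul (okmul x y) x = ((1 / 6 : ℂ) * (x * x).trace) • y := by
  have hs := okMu_add_conj
  have hp := okMu_mul_conj
  have hch := cayley_hamilton_polarized hx hy
  have htr : (x * y * x).trace = (x * x * y).trace := by
    rw [Matrix.trace_mul_comm, Matrix.mul_assoc]
  have htr' : (y * x * x).trace = (x * x * y).trace := by
    rw [Matrix.mul_assoc, Matrix.trace_mul_comm]
  unfold okmul
  generalize (starRingEnd ℂ) okMu = c at *
  generalize okMu = m at *
  simp only [sub_mul, add_mul, mul_sub, mul_add, smul_mul_assoc, mul_smul_comm, one_mul, mul_one,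
    Matrix.trace_sub, Matrix.trace_add, Matrix.trace_smul, htr, htr', hx, smul_eq_mul,
    ← Matrix.mul_assoc]
  have hc : c = 1 - m := by linear_combination hs
  subst hc
  ext i j
  have hij := congrFun (congrFun hch i) j
  simp only [Matrix.add_apply, Matrix.sub_apply, Matrix.smul_apply, smul_eq_mul] at hij ⊢
  linear_combination (1 / 3 : ℂ) * hij +
    ((y * x * x) i j + (x * x * y) i j - 2 * (x * y * x) i j) * hp

open scoped ComplexOrder in
lemma IsOkubo.eq_zero_of_trace_mul_self {x : OkM} (hx : IsOkubo x) (h : (x * x).trace = 0) :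
    x = 0 := by
  apply Matrix.trace_conjTranspose_mul_self_eq_zero_iff.mp
  rwa [hx.1.eq]

/-- STATEMENT 14: the Okubo algebra is a division algebra. -/
theorem okubo_division (x y : OkM) (hx : IsOkubo x) (hy : IsOkubo y)
    (h : okmul x y = 0) : x = 0 ∨ y = 0 := by
  have key := okmul_okmul_self hx.2 hy.2
  have h0 : okmul 0 x = 0 := by simp [okmul]
  rw [h, h0, eq_comm, smul_eq_zero] at key
  refine key.imp_left fun hn => hx.eq_zero_of_trace_mul_self ?_
  simpa using hn
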